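/- Let G be a finite simple graph with independence number 3, let a₁ be the number of vertices of G, a₂ the number of 2-element independent sets, and a₃ the number of 3-element independent sets, and let P(z) = a₁z + a₂z² + a₃z³ as a map ℂ → ℂ. If a₂² > 4·a₁·a₃, then the Julia set J(P) is not connected. -/

import Mathlib

open Set

/-- The real cubic without constant term and with the given coefficients, as a map on `ℂ`. -/
noncomputable def realCubic (a b c : ℝ) (z : ℂ) : ℂ :=
  (a : ℂ) * z + (b : ℂ) * z ^ 2 + (c : ℂ) * z ^ 3

/-- The points whose forward orbit under `f` is bounded. -/
def filledJulia (f : ℂ → ℂ) : Set ℂ :=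
  {z : ℂ | Bornology.IsBounded (Set.range fun n => f^[n] z)}

theorem mem_filledJulia {f : ℂ → ℂ} {z : ℂ} :
    z ∈ filledJulia f ↔ ∃ C, ∀ n, ‖f^[n] z‖ ≤ C := by
  simp [filledJulia, isBounded_iff_forall_norm_le]

/-- A preconnected set meeting both a set and its complement meets the frontier of the set. -/
theorem IsPreconnected.inter_frontier_nonempty_of_inter_compl {X : Type*} [TopologicalSpace X]
    {s t : Set X} (hs : IsPreconnected s) (ht : (s ∩ t).Nonempty) (ht' : (s ∩ tᶜ).Nonempty) :
    (s ∩ frontier t).Nonempty := by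
  by_contra! hne
  have hcov : s ⊆ interior t ∪ interior tᶜ := by
    rw [← compl_frontier_eq_union_interior]
    exact disjoint_iff_inter_eq_empty.mpr hne |>.subset_compl_right
  obtain ⟨x, hxs, hxt⟩ := ht
  obtain ⟨y, hys, hyt⟩ := ht'
  have hx : x ∈ interior t := (hcov hxs).resolve_right fun h => interior_subset h hxt
  have hy : y ∈ interior tᶜ := (hcov hys).resolve_left fun h => hyt (interior_subset h)
  obtain ⟨z, -, h1, h2⟩ := hs _ _ isOpen_interior isOpen_interior hcov ⟨x, hxs, hx⟩ ⟨y, hys, hy⟩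
  exact interior_subset h2 (interior_subset h1)

section Real

variable {a b c : ℝ}

theorem re_realCubic (z : ℂ) :
    (realCubic a b c z).re =
      a * z.re + b * (z.re ^ 2 - z.im ^ 2) + c * (z.re ^ 3 - 3 * z.re * z.im ^ 2) := by
  simp only [realCubic, pow_succ, pow_zero, one_mul, Complex.add_re, Complex.mul_re,
    Complex.mul_im, Complex.ofReal_re, Complex.ofReal_im]
  ring

theorem im_realCubic (z : ℂ) :
    (realCubic a b c z).im =
      z.im * (a + 2 * b * z.re + 3 * c * z.re ^ 2 - c * z.im ^ 2) := by
  simp only [realCubic, pow_succ, pow_zero, one_mul, Complex.add_im, Complex.mul_re,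
    Complex.mul_im, Complex.ofReal_re, Complex.ofReal_im]
  ring

theorem realCubic_ofReal (x : ℝ) :
    realCubic a b c x = ((a * x + b * x ^ 2 + c * x ^ 3 : ℝ) : ℂ) := by
  simp [realCubic]

theorem continuous_realCubic : Continuous (realCubic a b c) := by
  unfold realCubic
  fun_prop

/-- The left branch of the hyperbola `Im P = 0`, `z ∉ ℝ`, is mapped into the positive axis. -/
theorem re_realCubic_pos (ha : 0 < a) (hb : 0 ≤ b) (hc : 0 < c) (habc : 4 * a * c < b ^ 2) {z : ℂ}
    (hz : b + 3 * c * z.re ≤ 0)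
    (hh : a + 2 * b * z.re + 3 * c * z.re ^ 2 - c * z.im ^ 2 = 0) :
    0 < (realCubic a b c z).re := by
  obtain ⟨x, y⟩ := z
  rw [re_realCubic]
  simp only at hz hh ⊢
  have hy : 0 ≤ a * c + 2 * b * (c * x) + 3 * (c * x) ^ 2 := by
    have : a * c + 2 * b * (c * x) + 3 * (c * x) ^ 2 = (c * y) ^ 2 := by
      linear_combination c * hh
    rw [this]
    positivity
  obtain ⟨t, ht⟩ : ∃ t, t = -(b + 2 * (c * x)) := ⟨_, rfl⟩
  have htpos : 0 < t := by
    by_contra! hneg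
    have h1 : 0 ≤ b + 2 * (c * x) := by linarith
    have h2 : 0 ≤ -(b + 3 * (c * x)) := by linarith
    have h3 := mul_nonneg h1 h2
    have h4 := mul_nonneg hb h1
    nlinarith
  have key : c ^ 2 * (a * x + b * (x ^ 2 - y ^ 2) + c * (x ^ 3 - 3 * x * y ^ 2)) =
      t * (t ^ 2 + b * t + a * c) := by
    subst ht
    linear_combination (c * b + 3 * c ^ 2 * x) * hh
  have hpos : 0 < c ^ 2 * (a * x + b * (x ^ 2 - y ^ 2) + c * (x ^ 3 - 3 * x * y ^ 2)) := by
    rw [key]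
    positivity
  exact pos_of_mul_pos_right hpos (by positivity)

end Real

/-- If `f` at least doubles norms outside a ball, the filled-in Julia set consists of the points
whose orbit stays in that ball. -/
theorem mem_filledJulia_iff {f : ℂ → ℂ} {R : ℝ} (hR : 0 < R)
    (hf : ∀ z, R ≤ ‖z‖ → 2 * ‖z‖ ≤ ‖f z‖) (z : ℂ) :
    z ∈ filledJulia f ↔ ∀ n, ‖f^[n] z‖ ≤ R := by
  constructor
  · intro hz n
    by_contra! hn
    have grow : ∀ m, 2 ^ m * R ≤ ‖f^[n + m] z‖ := by
      intro m
      induction m with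
      | zero => simpa using hn.le
      | succ m ih =>
        have h1 : R ≤ 2 ^ m * R := le_mul_of_one_le_left hR.le (one_le_pow₀ (by norm_num))
        rw [← add_assoc, Function.iterate_succ_apply']
        have := hf _ (h1.trans ih)
        rw [pow_succ]
        linarith
    obtain ⟨C, hC⟩ := mem_filledJulia.mp hz
    obtain ⟨m, hm⟩ := pow_unbounded_of_one_lt (C / R) (one_lt_two : (1 : ℝ) < 2)
    rw [div_lt_iff₀ hR] at hm
    exact absurd (hC (n + m)) (not_le.mpr (hm.trans_le (grow m)))
  · intro h
    exact mem_filledJulia.mpr ⟨R, h⟩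

theorem isClosed_filledJulia {f : ℂ → ℂ} {R : ℝ} (hcont : Continuous f) (hR : 0 < R)
    (hf : ∀ z, R ≤ ‖z‖ → 2 * ‖z‖ ≤ ‖f z‖) : IsClosed (filledJulia f) := by
  have : filledJulia f = ⋂ n, {z | ‖f^[n] z‖ ≤ R} := by
    ext z
    simp [mem_filledJulia_iff hR hf]
  rw [this]
  exact isClosed_iInter fun n => isClosed_le (hcont.iterate n).norm continuous_const

section Real

variable {a b c : ℝ}

theorem two_mul_norm_le_norm_realCubic (ha : 0 ≤ a) (hb : 0 ≤ b) (hc : 1 ≤ c) {z : ℂ}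
    (hz : a + b + 2 ≤ ‖z‖) : 2 * ‖z‖ ≤ ‖realCubic a b c z‖ := by
  have h : realCubic a b c z = (c : ℂ) * z ^ 3 - (-((a : ℂ) * z + (b : ℂ) * z ^ 2)) := by
    unfold realCubic
    ring
  have h1 : c * ‖z‖ ^ 3 - (a * ‖z‖ + b * ‖z‖ ^ 2) ≤ ‖realCubic a b c z‖ := by
    rw [h]
    refine le_trans ?_ (norm_sub_norm_le _ _)
    have h2 := norm_add_le ((a : ℂ) * z) ((b : ℂ) * z ^ 2)
    simp only [norm_mul, norm_pow, norm_neg, Complex.norm_real, Real.norm_eq_abs,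
      abs_of_nonneg ha, abs_of_nonneg hb, abs_of_nonneg (zero_le_one.trans hc)] at h2 ⊢
    linarith
  refine le_trans ?_ h1
  have h3 : a + 2 ≤ ‖z‖ * (‖z‖ - b) := by nlinarith
  have h4 : 0 ≤ ‖z‖ ^ 3 * (c - 1) := mul_nonneg (by positivity) (by linarith)
  nlinarith [mul_nonneg (norm_nonneg z) (sub_nonneg.mpr h3)]

theorem notMem_filledJulia_of_realCubic_pos (ha : 2 ≤ a) (hb : 0 ≤ b) (hc : 1 ≤ c) {z : ℂ}
    (him : (realCubic a b c z).im = 0) (hre : 0 < (realCubic a b c z).re) :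
    z ∉ filledJulia (realCubic a b c) := by
  intro hz
  set r := (realCubic a b c z).re with hr
  have hz1 : realCubic a b c z = r := Complex.ext rfl (by simpa using him)
  have grow : ∀ n, ∃ x : ℝ, (realCubic a b c)^[n + 1] z = x ∧ 2 ^ n * r ≤ x := by
    intro n
    induction n with
    | zero => exact ⟨r, by simpa using hz1, by simp⟩
    | succ n ih =>
      obtain ⟨x, hx, hxr⟩ := ih
      refine ⟨_, by rw [Function.iterate_succ_apply', hx, realCubic_ofReal], ?_⟩
      have hx0 : 0 < x := lt_of_lt_of_le (by positivity) hxr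
      have h1 : 0 ≤ b * x ^ 2 + c * x ^ 3 := by positivity
      have h2 := mul_le_mul_of_nonneg_right ha hx0.le
      rw [pow_succ]
      linarith
  obtain ⟨C, hC⟩ := mem_filledJulia.mp hz
  obtain ⟨n, hn⟩ := pow_unbounded_of_one_lt (C / r) (one_lt_two : (1 : ℝ) < 2)
  rw [div_lt_iff₀ hre] at hn
  obtain ⟨x, hx, hxr⟩ := grow n
  have h1 := hC (n + 1)
  simp only [hx, Complex.norm_real, Real.norm_eq_abs] at h1
  linarith [le_abs_self x]

theorem not_isConnected_frontier_filledJulia (ha : 2 ≤ a) (hb : 0 ≤ b) (hc : 1 ≤ c)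
    (habc : 4 * a * c < b ^ 2) : ¬ IsConnected (frontier (filledJulia (realCubic a b c))) := by
  have ha0 : 0 < a := by linarith
  have hc0 : 0 < c := by linarith
  have hbpos : 0 < b := hb.lt_of_ne (by rintro rfl; nlinarith [mul_pos ha0 hc0])
  have hR : 0 < a + b + 2 := by linarith
  have hesc : ∀ z, a + b + 2 ≤ ‖z‖ → 2 * ‖z‖ ≤ ‖realCubic a b c z‖ := fun z hz =>
    two_mul_norm_le_norm_realCubic ha0.le hb hc hz
  have hclosed := isClosed_filledJulia continuous_realCubic hR hesc
  have hfar : ∀ z ∈ filledJulia (realCubic a b c), ‖z‖ ≤ a + b + 2 := fun z hz =>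
    (mem_filledJulia_iff hR hesc z).mp hz 0
  have hzero : realCubic a b c 0 = 0 := by simp [realCubic]
  have hmem : ∀ z, realCubic a b c z = 0 → z ∈ filledJulia (realCubic a b c) := by
    intro z hz
    have h1 : ∀ n, (realCubic a b c)^[n + 1] z = 0 := fun n => by
      rw [Function.iterate_succ_apply, hz, Function.iterate_fixed hzero]
    refine mem_filledJulia.mpr ⟨‖z‖, ?_⟩
    rintro (_ | n)
    · simp
    · simp [h1]
  have hmeet : ∀ s : Set ℝ, IsPreconnected s → ∀ x ∈ s, realCubic a b c x = 0 →
      (∃ y ∈ s, a + b + 2 < |y|) →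
      ∃ y ∈ s, (y : ℂ) ∈ frontier (filledJulia (realCubic a b c)) := by
    rintro s hs x hx hx0 ⟨y, hy, hyR⟩
    have hpre := hs.image _ Complex.continuous_ofReal.continuousOn
    obtain ⟨_, ⟨w, hw, rfl⟩, hwf⟩ := hpre.inter_frontier_nonempty_of_inter_compl
      ⟨_, mem_image_of_mem _ hx, hmem _ hx0⟩
      ⟨_, mem_image_of_mem _ hy, fun h => by
        have := hfar _ h
        rw [Complex.norm_real, Real.norm_eq_abs] at this
        linarith⟩
    exact ⟨w, hw, hwf⟩
  let h : ℂ → ℝ := fun z => a + 2 * b * z.re + 3 * c * z.re ^ 2 - c * z.im ^ 2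
  have hcont : Continuous h := by fun_prop
  let l : ℂ → ℝ := fun z => b + 3 * c * z.re
  have lcont : Continuous l := by fun_prop
  let U : Set ℂ := {z | l z < 0} ∩ {z | 0 < h z}
  let W : Set ℂ := {z | 0 < l z} ∪ {z | h z < 0}
  have hU : IsOpen U := (isOpen_lt lcont continuous_const).inter (isOpen_lt continuous_const hcont)
  have hW : IsOpen W := (isOpen_lt continuous_const lcont).union (isOpen_lt hcont continuous_const)
  have hcover : frontier (filledJulia (realCubic a b c)) ⊆ U ∪ W := by
    intro z hz
    have hzK := hclosed.frontier_subset hz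
    by_contra hzUW
    simp only [U, W, mem_union, mem_inter_iff, mem_ofPred_eq, not_or, not_and, not_lt] at hzUW
    obtain ⟨h1, h2, h3⟩ := hzUW
    have hh : h z = 0 := by
      rcases h2.lt_or_eq with h4 | h4
      · exact le_antisymm (h1 h4) h3
      · exfalso
        simp only [h, l] at h3 h4
        have h5 : 0 ≤ c * z.im ^ 2 := by positivity
        have h6 : 3 * c * (a + 2 * b * z.re + 3 * c * z.re ^ 2) = 3 * a * c - b ^ 2 := by
          linear_combination (b + 3 * c * z.re) * h4
        nlinarith [mul_pos ha0 hc0]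
    refine notMem_filledJulia_of_realCubic_pos ha hb hc ?_
      (re_realCubic_pos ha0 hb hc0 habc h2 hh) hzK
    rw [im_realCubic]
    exact mul_eq_zero_of_right _ hh
  have hUJ : (frontier (filledJulia (realCubic a b c)) ∩ U).Nonempty := by
    obtain ⟨d, hd0, hd⟩ : ∃ d : ℝ, 0 < d ∧ d ^ 2 = b ^ 2 - 4 * a * c :=
      ⟨√(b ^ 2 - 4 * a * c), Real.sqrt_pos.mpr (by linarith), Real.sq_sqrt (by linarith)⟩
    obtain ⟨x, hx⟩ : ∃ x : ℝ, 2 * c * x = -b - d := ⟨(-b - d) / (2 * c), by field_simp⟩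
    have hroot : a + b * x + c * x ^ 2 = 0 := by
      have : 4 * c * (a + b * x + c * x ^ 2) = 0 := by
        linear_combination (2 * c * x + b - d) * hx + hd
      exact (mul_eq_zero.mp this).resolve_left (by positivity)
    obtain ⟨y, hy, hyJ⟩ := hmeet (Iic x) isPreconnected_Iic x self_mem_Iic
      (by
        rw [realCubic_ofReal, Complex.ofReal_eq_zero]
        linear_combination x * hroot)
      ⟨min x (-(a + b + 3)), mem_Iic.mpr (min_le_left _ _), by
        have := min_le_right x (-(a + b + 3))
        linarith [neg_le_abs (min x (-(a + b + 3)))]⟩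
    have hyx : 2 * c * y ≤ -b - d := hx ▸ mul_le_mul_of_nonneg_left hy (by positivity)
    refine ⟨y, hyJ, ?_, ?_⟩
    · simp only [l, mem_ofPred_eq, Complex.ofReal_re]
      linarith
    · simp only [h, mem_ofPred_eq, Complex.ofReal_re, Complex.ofReal_im]
      have : 0 < 4 * c * (a + 2 * b * y + 3 * c * y ^ 2) := by
        nlinarith [mul_nonneg (by linarith : 0 ≤ -b - d - 2 * c * y) hb,
          mul_nonneg (by linarith : 0 ≤ -b - d - 2 * c * y) hd0.le, mul_pos hbpos hd0,
          sq_nonneg (-b - d - 2 * c * y)]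
      have := pos_of_mul_pos_right this (by positivity)
      linarith
  have hWJ : (frontier (filledJulia (realCubic a b c)) ∩ W).Nonempty := by
    obtain ⟨y, hy, hyJ⟩ := hmeet (Ici 0) isPreconnected_Ici 0 self_mem_Ici (by simpa using hzero)
      ⟨a + b + 3, by simp only [mem_Ici]; linarith, by
        linarith [le_abs_self (a + b + 3)]⟩
    refine ⟨y, hyJ, Or.inl ?_⟩
    have : 0 ≤ 3 * c * y := mul_nonneg (by positivity) hy
    simp only [l, mem_ofPred_eq, Complex.ofReal_re]
    linarith
  intro hconn
  obtain ⟨z, -, hzU, hzW⟩ := hconn.isPreconnected U W hU hW hcover hUJ hWJ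
  simp only [U, W, mem_union, mem_inter_iff, mem_ofPred_eq] at hzU hzW
  exact hzW.elim (lt_asymm hzU.1) (lt_asymm · hzU.2)

end Real


/-- For a finite simple graph with independence number 3 whose reduced
independence polynomial is `P(z) = a₁z + a₂z² + a₃z³`, if `a₂² > 4·a₁·a₃` then the Julia
set of `P` is not connected. -/
theorem stmt_11 {V : Type*} [Fintype V] [DecidableEq V]
    (G : SimpleGraph V) [DecidableRel G.Adj]
    (a₁ a₂ a₃ : ℕ)
    (ha₁ : a₁ = Fintype.card V)
    (ha₂ : a₂ = (Finset.univ.filter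
      (fun s : Finset V => s.card = 2 ∧ ∀ u ∈ s, ∀ v ∈ s, ¬ G.Adj u v)).card)
    (ha₃ : a₃ = (Finset.univ.filter
      (fun s : Finset V => s.card = 3 ∧ ∀ u ∈ s, ∀ v ∈ s, ¬ G.Adj u v)).card)
    (hindep3 : ∃ s : Finset V, s.card = 3 ∧ ∀ u ∈ s, ∀ v ∈ s, ¬ G.Adj u v)
    (hindep4 : ¬ ∃ s : Finset V, s.card = 4 ∧ ∀ u ∈ s, ∀ v ∈ s, ¬ G.Adj u v)
    (P : ℂ → ℂ)
    (hP : ∀ z, P z = a₁ * z + a₂ * z ^ 2 + a₃ * z ^ 3)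
    (hcond : 4 * a₁ * a₃ < a₂ ^ 2) :
    ¬ IsConnected
        (frontier {z : ℂ | Bornology.IsBounded (Set.range fun n => P^[n] z)}) := by
  have h3 : 3 ≤ a₁ := by
    obtain ⟨s, hs, -⟩ := hindep3
    rw [ha₁, ← hs]
    exact s.card_le_univ
  have ha₃pos : 1 ≤ a₃ := by
    obtain ⟨s, hs⟩ := hindep3
    rw [ha₃, Nat.one_le_iff_ne_zero, Finset.card_ne_zero]
    exact ⟨s, by simpa using hs⟩
  obtain rfl : P = fun z =>
      ((a₁ : ℝ) : ℂ) * z + ((a₂ : ℝ) : ℂ) * z ^ 2 + ((a₃ : ℝ) : ℂ) * z ^ 3 := by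
    funext z
    simp [hP]
  exact not_isConnected_frontier_filledJulia (by exact_mod_cast (by omega : 2 ≤ a₁))
    (Nat.cast_nonneg _) (by exact_mod_cast ha₃pos) (by exact_mod_cast hcond)
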